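/- Let D := {(x, x̃) ∈ ℝ² : x > 0, x̃ > 0, x̃ < √(1−x²), x < √(1−x̃²)}, and for (x, x̃) ∈ D define l(x, x̃) := 2·√(1−x²)·sin(π/5 − (1/5)·arcsin(x̃/√(1−x²))) and l̃(x, x̃) := 2·√(1−x̃²)·sin(π/5 − (1/5)·arcsin(x/√(1−x̃²))). Then there exists a continuous map γ : [0,1] → D such that: (a) every positive solution of the equilateral pentagonal Siamese system lies in the image of γ; (b) for every t ∈ [0,1], |l(γ(t)) − 1| < 0.004 and |l̃(γ(t)) − 1| < 0.004; and (c) there exist s, t ∈ [0,1] such that the first coordinates satisfy (γ(s)₁ − γ(t)₁)/γ(t)₁ > 5.9. (This is the model flexibility of the equilateral pentagonal Siamese dipyramids: a continuous deformation with relative variations in edge lengths below 0.004 produces relative variations in heights exceeding 5.9.) -/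

import Mathlib

/-- `(x, x̃) = p` is a positive solution of the equilateral pentagonal Siamese
system. -/
def EqPentSol (p : ℝ × ℝ) : Prop :=
  0 < p.1 ∧ p.1 < Real.sqrt 3 / 2 ∧ 0 < p.2 ∧ p.2 < Real.sqrt 3 / 2 ∧
  p.2 = (5 * p.1 ^ 4 - 5 * p.1 ^ 2 + 1) / (2 * (1 - p.1 ^ 2) ^ 2) ∧
  p.1 = (5 * p.2 ^ 4 - 5 * p.2 ^ 2 + 1) / (2 * (1 - p.2 ^ 2) ^ 2)

/-- The moduli domain of pentagonal Siamese dipyramids. -/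
def ModuliD : Set (ℝ × ℝ) :=
  {p | 0 < p.1 ∧ 0 < p.2 ∧ p.2 < Real.sqrt (1 - p.1 ^ 2) ∧
    p.1 < Real.sqrt (1 - p.2 ^ 2)}

/-- The edge length `l` of the pentagonal Siamese dipyramid with heights `p`. -/
noncomputable def edgeL (p : ℝ × ℝ) : ℝ :=
  2 * Real.sqrt (1 - p.1 ^ 2) *
    Real.sin (Real.pi / 5 - (1 / 5) * Real.arcsin (p.2 / Real.sqrt (1 - p.1 ^ 2)))

/-- The edge length `l̃` of the pentagonal Siamese dipyramid with heights `p`. -/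
noncomputable def edgeLt (p : ℝ × ℝ) : ℝ :=
  2 * Real.sqrt (1 - p.2 ^ 2) *
    Real.sin (Real.pi / 5 - (1 / 5) * Real.arcsin (p.1 / Real.sqrt (1 - p.2 ^ 2)))

/-- Polynomial whose sign compares the edge length `edgeL (x, y)` with `L`. -/
def edgeF (x y L : ℝ) : ℝ :=
  2 * y * (1 - x ^ 2) ^ 2 - (L ^ 5 - 5 * L ^ 3 * (1 - x ^ 2) + 5 * L * (1 - x ^ 2) ^ 2)

theorem sin_five (t : ℝ) :
    Real.sin (5 * t) = 16 * Real.sin t ^ 5 - 20 * Real.sin t ^ 3 + 5 * Real.sin t := by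
  have h : 5 * t = 2 * t + 3 * t := by ring
  have hc : Real.cos t ^ 2 = 1 - Real.sin t ^ 2 := by
    have := Real.sin_sq_add_cos_sq t
    linarith
  have hc4 : Real.cos t ^ 4 = (1 - Real.sin t ^ 2) ^ 2 := by
    rw [← hc]; ring
  rw [h, Real.sin_add, Real.sin_two_mul, Real.cos_two_mul, Real.sin_three_mul,
    Real.cos_three_mul]
  ring_nf
  rw [hc4, hc]
  ring

set_option maxHeartbeats 1000000 in
/-- The local edge-length comparison data. -/
theorem edge_aux {x y : ℝ} (hx : 0 < x) (hx6 : x ≤ 3 / 5) (hy : 0 < y) (hy6 : y ≤ 3 / 5) :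
    (0 < edgeF x y (251 / 250) → edgeL (x, y) < 251 / 250) ∧
    (edgeF x y (249 / 250) < 0 → 249 / 250 < edgeL (x, y)) := by
  have hR : 0 < 1 - x ^ 2 := by nlinarith
  set r := Real.sqrt (1 - x ^ 2) with hr
  have hr0 : 0 < r := Real.sqrt_pos.mpr hR
  have hr2 : r ^ 2 = 1 - x ^ 2 := Real.sq_sqrt hR.le
  have hr8 : 4 / 5 ≤ r := by
    rw [hr]; apply Real.le_sqrt_of_sq_le; nlinarith
  have hr1 : r ≤ 1 := by nlinarith
  set w := y / r with hw
  have hw0 : 0 < w := div_pos hy hr0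
  have hw1 : w ≤ 1 := by
    rw [hw, div_le_one hr0]; linarith
  have hwr : y = w * r := by rw [hw]; field_simp
  set θ := Real.pi / 5 - (1 / 5) * Real.arcsin w with hθ
  have hA0 : 0 ≤ Real.arcsin w := Real.arcsin_nonneg.mpr hw0.le
  have hA1 : Real.arcsin w ≤ Real.pi / 2 := Real.arcsin_le_pi_div_two w
  have hpi := Real.pi_pos
  have hpi4 := Real.pi_lt_d2
  have hpi3 := Real.pi_gt_three
  have hθ1 : Real.pi / 10 ≤ θ := by rw [hθ]; linarith
  have hθ2 : θ ≤ Real.pi / 5 := by rw [hθ]; linarith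
  have hs5 : Real.sin (5 * θ) = w := by
    have : 5 * θ = Real.pi - Real.arcsin w := by rw [hθ]; ring
    rw [this, Real.sin_pi_sub, Real.sin_arcsin (by linarith) hw1]
  have hl : edgeL (x, y) = 2 * r * Real.sin θ := rfl
  -- angles of the reference lengths
  have key : ∀ L : ℝ, 249 / 250 ≤ L → L ≤ 251 / 250 →
      ∃ φ, Real.pi / 10 ≤ φ ∧ φ ≤ 3 * Real.pi / 10 ∧ Real.sin φ = L / (2 * r) ∧
        2 * r ^ 5 * Real.sin (5 * φ) =
          L ^ 5 - 5 * L ^ 3 * (1 - x ^ 2) + 5 * L * (1 - x ^ 2) ^ 2 := by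
    intro L hL1 hL2
    have h1 : L / (2 * r) ≤ 4 / 5 := by
      rw [div_le_iff₀ (by positivity)]; linarith
    have h2 : 2 / 5 ≤ L / (2 * r) := by
      rw [le_div_iff₀ (by positivity)]; linarith
    have hsin : Real.sin (Real.arcsin (L / (2 * r))) = L / (2 * r) :=
      Real.sin_arcsin (by linarith) (by linarith)
    refine ⟨Real.arcsin (L / (2 * r)), ?_, ?_, hsin, ?_⟩
    · rw [Real.le_arcsin_iff_sin_le' ⟨by linarith, by linarith⟩]
      have : Real.sin (Real.pi / 10) ≤ Real.pi / 10 := Real.sin_le (by positivity)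
      linarith
    · rw [Real.arcsin_le_iff_le_sin' ⟨by linarith, by linarith⟩]
      have : 3 * Real.pi / 10 = Real.pi / 2 - Real.pi / 5 := by ring
      rw [this, Real.sin_pi_div_two_sub, Real.cos_pi_div_five]
      have : (11 / 5 : ℝ) ≤ Real.sqrt 5 := by
        apply Real.le_sqrt_of_sq_le; norm_num
      linarith
    · rw [sin_five, hsin, ← hr2]
      field_simp
      ring
  have hF : ∀ L : ℝ, edgeF x y L = 2 * r ^ 5 * Real.sin (5 * θ) -
      (L ^ 5 - 5 * L ^ 3 * (1 - x ^ 2) + 5 * L * (1 - x ^ 2) ^ 2) := by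
    intro L
    rw [hs5, edgeF, ← hr2]
    conv_lhs => rw [hwr]
    ring
  rw [hl]
  constructor
  · intro h
    obtain ⟨φ, h1, h2, h3, h4⟩ := key (251 / 250) (by norm_num) (by norm_num)
    rw [hF, ← h4] at h
    have h5 : Real.sin (5 * φ) < Real.sin (5 * θ) := by
      have : 0 < 2 * r ^ 5 := by positivity
      exact lt_of_mul_lt_mul_left (by linarith) this.le
    have h6 : θ < φ := by
      by_contra hn
      push Not at hn
      have := Real.cos_le_cos_of_nonneg_of_le_pi (x := 5 * φ - Real.pi / 2)
        (y := 5 * θ - Real.pi / 2) (by linarith) (by linarith) (by linarith)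
      rw [Real.cos_sub_pi_div_two, Real.cos_sub_pi_div_two] at this
      linarith
    have h7 : Real.sin θ < Real.sin φ :=
      Real.sin_lt_sin_of_lt_of_le_pi_div_two (by linarith) (by linarith) h6
    rw [h3, lt_div_iff₀ (by positivity)] at h7
    linarith
  · intro h
    obtain ⟨φ, h1, h2, h3, h4⟩ := key (249 / 250) (by norm_num) (by norm_num)
    rw [hF, ← h4] at h
    have h5 : Real.sin (5 * θ) < Real.sin (5 * φ) := by
      have : 0 < 2 * r ^ 5 := by positivity
      exact lt_of_mul_lt_mul_left (by linarith) this.le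
    have h6 : φ < θ := by
      by_contra hn
      push Not at hn
      have := Real.cos_le_cos_of_nonneg_of_le_pi (x := 5 * θ - Real.pi / 2)
        (y := 5 * φ - Real.pi / 2) (by linarith) (by linarith) (by linarith)
      rw [Real.cos_sub_pi_div_two, Real.cos_sub_pi_div_two] at this
      linarith
    have h7 : Real.sin φ < Real.sin θ :=
      Real.sin_lt_sin_of_lt_of_le_pi_div_two (by linarith) (by linarith) h6
    rw [h3, div_lt_iff₀ (by positivity)] at h7
    linarith

/-- The set of heights whose edge lengths are within `0.004` of `1`. -/
def goodSet : Set (ℝ × ℝ) :=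
  {p | p ∈ ModuliD ∧ |edgeL p - 1| < 0.004 ∧ |edgeLt p - 1| < 0.004}

theorem mem_goodSet {x y : ℝ} (hx : 0 < x) (hx6 : x ≤ 3 / 5) (hy : 0 < y) (hy6 : y ≤ 3 / 5)
    (h1 : 0 < edgeF x y (251 / 250)) (h2 : edgeF x y (249 / 250) < 0)
    (h3 : 0 < edgeF y x (251 / 250)) (h4 : edgeF y x (249 / 250) < 0) :
    (x, y) ∈ goodSet := by
  obtain ⟨a1, a2⟩ := edge_aux hx hx6 hy hy6
  obtain ⟨b1, b2⟩ := edge_aux hy hy6 hx hx6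
  have hsw : edgeLt (x, y) = edgeL (y, x) := rfl
  have a1 := a1 h1
  have a2 := a2 h2
  have b1 := b1 h3
  have b2 := b2 h4
  refine ⟨⟨hx, hy, ?_, ?_⟩, ?_, ?_⟩
  · apply Real.lt_sqrt_of_sq_lt
    show y ^ 2 < 1 - x ^ 2
    nlinarith
  · apply Real.lt_sqrt_of_sq_lt
    show x ^ 2 < 1 - y ^ 2
    nlinarith
  · rw [abs_lt]; constructor <;> norm_num <;> linarith
  · rw [hsw, abs_lt]; constructor <;> norm_num <;> linarith

theorem swap_goodSet {p : ℝ × ℝ} (h : p ∈ goodSet) : p.swap ∈ goodSet := by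
  obtain ⟨⟨a, b, c, d⟩, e, f⟩ := h
  exact ⟨⟨b, a, d, c⟩, f, e⟩

theorem swap_joined {p q : ℝ × ℝ} (h : JoinedIn goodSet p q) :
    JoinedIn goodSet p.swap q.swap := by
  refine (h.map continuous_swap).mono ?_
  rintro _ ⟨z, hz, rfl⟩
  exact swap_goodSet hz

/-- Monotonicity of the normalized comparison polynomial. -/
theorem edgeF_mono {p x u y L : ℝ} (hp : 0 ≤ p) (hpx : p ≤ x) (hx : x ≤ 3 / 5) (huy : u ≤ y)
    (hL1 : 249 / 250 ≤ L) (hL2 : L ≤ 251 / 250) :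
    edgeF p u L / (1 - p ^ 2) ^ 2 ≤ edgeF x y L / (1 - x ^ 2) ^ 2 := by
  have hR : 16 / 25 ≤ 1 - x ^ 2 := by nlinarith
  have hA : 1 - x ^ 2 ≤ 1 - p ^ 2 := by nlinarith
  unfold edgeF
  generalize 1 - x ^ 2 = R at *
  generalize 1 - p ^ 2 = A at *
  have hR0 : 0 < R := by linarith
  have hA0 : 0 < A := by linarith
  have e : ∀ z T : ℝ, 0 < T →
      (2 * z * T ^ 2 - (L ^ 5 - 5 * L ^ 3 * T + 5 * L * T ^ 2)) / T ^ 2 =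
        2 * z - 5 * L + 5 * L ^ 3 * T⁻¹ - L ^ 5 * T⁻¹ ^ 2 := by
    intro z T hT
    field_simp
    ring
  rw [e u A hA0, e y R hR0]
  have i1 : A⁻¹ ≤ R⁻¹ := inv_anti₀ hR0 hA
  have i2 : R⁻¹ ≤ 25 / 16 := by
    rw [inv_le_comm₀ hR0 (by norm_num)]; linarith
  generalize R⁻¹ = s at *
  generalize A⁻¹ = t at *
  have hL3 : 0 < L ^ 3 := by positivity
  have hLL : L ^ 2 ≤ 101 / 100 := by nlinarith
  have h1 : 0 ≤ 5 - L ^ 2 * (s + t) := by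
    nlinarith [sq_nonneg L]
  have h2 : 0 ≤ L ^ 3 * ((s - t) * (5 - L ^ 2 * (s + t))) :=
    mul_nonneg hL3.le (mul_nonneg (by linarith) h1)
  nlinarith

theorem edgeF_pos {p x u y L : ℝ} (hp : 0 ≤ p) (hpx : p ≤ x) (hx : x ≤ 3 / 5) (huy : u ≤ y)
    (hL1 : 249 / 250 ≤ L) (hL2 : L ≤ 251 / 250) (h : 0 < edgeF p u L) : 0 < edgeF x y L := by
  have hm := edgeF_mono hp hpx hx huy hL1 hL2
  have hR : 0 < 1 - x ^ 2 := by nlinarith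
  have hA : 0 < 1 - p ^ 2 := by nlinarith
  have h0 : 0 < edgeF p u L / (1 - p ^ 2) ^ 2 := by positivity
  have h1 := lt_of_lt_of_le h0 hm
  exact (div_pos_iff_of_pos_right (by positivity)).mp h1

theorem edgeF_neg {p x u y L : ℝ} (hp : 0 ≤ p) (hpx : p ≤ x) (hx : x ≤ 3 / 5) (huy : u ≤ y)
    (hL1 : 249 / 250 ≤ L) (hL2 : L ≤ 251 / 250) (h : edgeF x y L < 0) : edgeF p u L < 0 := by
  have hm := edgeF_mono hp hpx hx huy hL1 hL2
  have hR : 0 < 1 - x ^ 2 := by nlinarith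
  have hA : 0 < 1 - p ^ 2 := by nlinarith
  have h0 : edgeF x y L / (1 - x ^ 2) ^ 2 < 0 := div_neg_of_neg_of_pos h (by positivity)
  have h1 := lt_of_le_of_lt hm h0
  by_contra hn
  push Not at hn
  have : 0 ≤ edgeF p u L / (1 - p ^ 2) ^ 2 := by positivity
  linarith

/-- Two points of a good box are joined in the good set. -/
theorem box_joined {p q u v : ℝ} (hp : 0 < p) (hq : q ≤ 3 / 5) (hu : 0 < u) (hv : v ≤ 3 / 5)
    (h1 : 0 < edgeF p u (251 / 250)) (h2 : edgeF q v (249 / 250) < 0)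
    (h3 : 0 < edgeF u p (251 / 250)) (h4 : edgeF v q (249 / 250) < 0)
    {a b : ℝ × ℝ} (ha : a ∈ Set.Icc p q ×ˢ Set.Icc u v) (hb : b ∈ Set.Icc p q ×ˢ Set.Icc u v) :
    JoinedIn goodSet a b := by
  apply JoinedIn.of_segment_subset
  have hc : Convex ℝ (Set.Icc p q ×ˢ Set.Icc u v) := (convex_Icc p q).prod (convex_Icc u v)
  refine (hc.segment_subset ha hb).trans ?_
  rintro ⟨x, y⟩ ⟨⟨hx1, hx2⟩, hy1, hy2⟩
  simp only at hx1 hx2 hy1 hy2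
  apply mem_goodSet (by linarith) (by linarith) (by linarith) (by linarith)
  · exact edgeF_pos hp.le hx1 (by linarith) hy1 (by norm_num) (by norm_num) h1
  · exact edgeF_neg (by linarith) hx2 (by linarith) hy2 (by norm_num) (by norm_num) h2
  · exact edgeF_pos hu.le hy1 (by linarith) hx1 (by norm_num) (by norm_num) h3
  · exact edgeF_neg (by linarith) hy2 (by linarith) hx2 (by norm_num) (by norm_num) h4

/-- The Bernstein form of `edgeF` along a segment. -/
theorem edgeF_bernstein (p v q u L s t : ℝ) (hst : s + t = 1) :
    edgeF (s * p + t * q) (s * v + t * u) L =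
      edgeF p v L * s ^ 5 +
      (2 * (u * (1 - p ^ 2) ^ 2 + 4 * v * (1 - p ^ 2) * (1 - p * q)) - 5 * L ^ 5
        + 5 * L ^ 3 * (3 * (1 - p ^ 2) + 2 * (1 - p * q))
        - 5 * L * ((1 - p ^ 2) ^ 2 + 4 * (1 - p ^ 2) * (1 - p * q))) * (s ^ 4 * t) +
      (2 * (v * (4 * (1 - p * q) ^ 2 + 2 * (1 - p ^ 2) * (1 - q ^ 2))
          + 4 * u * (1 - p ^ 2) * (1 - p * q)) - 10 * L ^ 5
        + 5 * L ^ 3 * (3 * (1 - p ^ 2) + 6 * (1 - p * q) + (1 - q ^ 2))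
        - 5 * L * (4 * (1 - p * q) ^ 2 + 2 * (1 - p ^ 2) * (1 - q ^ 2)
          + 4 * (1 - p ^ 2) * (1 - p * q))) * (s ^ 3 * t ^ 2) +
      (2 * (u * (4 * (1 - p * q) ^ 2 + 2 * (1 - p ^ 2) * (1 - q ^ 2))
          + 4 * v * (1 - q ^ 2) * (1 - p * q)) - 10 * L ^ 5
        + 5 * L ^ 3 * (3 * (1 - q ^ 2) + 6 * (1 - p * q) + (1 - p ^ 2))
        - 5 * L * (4 * (1 - p * q) ^ 2 + 2 * (1 - p ^ 2) * (1 - q ^ 2)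
          + 4 * (1 - q ^ 2) * (1 - p * q))) * (s ^ 2 * t ^ 3) +
      (2 * (v * (1 - q ^ 2) ^ 2 + 4 * u * (1 - q ^ 2) * (1 - p * q)) - 5 * L ^ 5
        + 5 * L ^ 3 * (3 * (1 - q ^ 2) + 2 * (1 - p * q))
        - 5 * L * ((1 - q ^ 2) ^ 2 + 4 * (1 - q ^ 2) * (1 - p * q))) * (s * t ^ 4) +
      edgeF q u L * t ^ 5 := by
  obtain rfl : s = 1 - t := by linarith
  unfold edgeF
  ring

/-- The Bernstein coefficients of `σ * edgeF` along the segment are positive. -/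
def BPos (σ p v q u L : ℝ) : Prop :=
  0 < σ * edgeF p v L ∧
  0 < σ * (2 * (u * (1 - p ^ 2) ^ 2 + 4 * v * (1 - p ^ 2) * (1 - p * q)) - 5 * L ^ 5
        + 5 * L ^ 3 * (3 * (1 - p ^ 2) + 2 * (1 - p * q))
        - 5 * L * ((1 - p ^ 2) ^ 2 + 4 * (1 - p ^ 2) * (1 - p * q))) ∧
  0 < σ * (2 * (v * (4 * (1 - p * q) ^ 2 + 2 * (1 - p ^ 2) * (1 - q ^ 2))
          + 4 * u * (1 - p ^ 2) * (1 - p * q)) - 10 * L ^ 5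
        + 5 * L ^ 3 * (3 * (1 - p ^ 2) + 6 * (1 - p * q) + (1 - q ^ 2))
        - 5 * L * (4 * (1 - p * q) ^ 2 + 2 * (1 - p ^ 2) * (1 - q ^ 2)
          + 4 * (1 - p ^ 2) * (1 - p * q))) ∧
  0 < σ * (2 * (u * (4 * (1 - p * q) ^ 2 + 2 * (1 - p ^ 2) * (1 - q ^ 2))
          + 4 * v * (1 - q ^ 2) * (1 - p * q)) - 10 * L ^ 5
        + 5 * L ^ 3 * (3 * (1 - q ^ 2) + 6 * (1 - p * q) + (1 - p ^ 2))
        - 5 * L * (4 * (1 - p * q) ^ 2 + 2 * (1 - p ^ 2) * (1 - q ^ 2)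
          + 4 * (1 - q ^ 2) * (1 - p * q))) ∧
  0 < σ * (2 * (v * (1 - q ^ 2) ^ 2 + 4 * u * (1 - q ^ 2) * (1 - p * q)) - 5 * L ^ 5
        + 5 * L ^ 3 * (3 * (1 - q ^ 2) + 2 * (1 - p * q))
        - 5 * L * ((1 - q ^ 2) ^ 2 + 4 * (1 - q ^ 2) * (1 - p * q))) ∧
  0 < σ * edgeF q u L

theorem BPos.pos {σ p v q u L : ℝ} (h : BPos σ p v q u L) {s t : ℝ} (hs : 0 ≤ s) (ht : 0 ≤ t)
    (hst : s + t = 1) : 0 < σ * edgeF (s * p + t * q) (s * v + t * u) L := by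
  obtain ⟨h0, h1, h2, h3, h4, h5⟩ := h
  rw [edgeF_bernstein p v q u L s t hst]
  have g1 := mul_nonneg h1.le (by positivity : 0 ≤ s ^ 4 * t)
  have g2 := mul_nonneg h2.le (by positivity : 0 ≤ s ^ 3 * t ^ 2)
  have g3 := mul_nonneg h3.le (by positivity : 0 ≤ s ^ 2 * t ^ 3)
  have g4 := mul_nonneg h4.le (by positivity : 0 ≤ s * t ^ 4)
  have g05 : 0 < σ * edgeF p v L * s ^ 5 + σ * edgeF q u L * t ^ 5 := by
    rcases hs.eq_or_lt with rfl | hs'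
    · obtain rfl : t = 1 := by linarith
      simpa using h5
    · have := mul_pos h0 (pow_pos hs' 5)
      have := mul_nonneg h5.le (pow_nonneg ht 5)
      linarith
  linarith

/-- The endpoints of a good segment are joined in the good set. -/
theorem seg_joined {p v q u : ℝ} (hp : 0 < p) (hp6 : p ≤ 3 / 5) (hq : 0 < q) (hq6 : q ≤ 3 / 5)
    (hu : 0 < u) (hu6 : u ≤ 3 / 5) (hv : 0 < v) (hv6 : v ≤ 3 / 5)
    (h1 : BPos 1 p v q u (251 / 250)) (h2 : BPos (-1) p v q u (249 / 250))
    (h3 : BPos 1 v p u q (251 / 250)) (h4 : BPos (-1) v p u q (249 / 250)) :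
    JoinedIn goodSet (p, v) (q, u) := by
  apply JoinedIn.of_segment_subset
  rintro z ⟨s, t, hs, ht, hst, rfl⟩
  have e : s • (p, v) + t • (q, u) = (s * p + t * q, s * v + t * u) := by simp
  rw [e]
  have h1 := h1.pos hs ht hst
  have h2 := h2.pos hs ht hst
  have h3 := h3.pos hs ht hst
  have h4 := h4.pos hs ht hst
  have hI : ∀ a b : ℝ, 0 < a → a ≤ 3 / 5 → 0 < b → b ≤ 3 / 5 →
      s * a + t * b ∈ Set.Ioc (0:ℝ) (3 / 5) := fun a b ha ha' hb hb' =>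
    (convex_Ioc (0:ℝ) (3 / 5)) ⟨ha, ha'⟩ ⟨hb, hb'⟩ hs ht hst
  have i1 := hI p q hp hp6 hq hq6
  have i2 := hI v u hv hv6 hu hu6
  exact mem_goodSet i1.1 i1.2 i2.1 i2.2 (by linarith) (by linarith) (by linarith) (by linarith)

theorem chain_joined : JoinedIn goodSet (0.0725, 0.492) (0.324, 0.33) := by
  have s1 : JoinedIn goodSet (0.0725, 0.492) (0.164, 0.44956) := by
    apply seg_joined <;> norm_num [BPos, edgeF]
  have s2 : JoinedIn goodSet (0.164, 0.44956) (0.1965, 0.43042) := by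
    apply seg_joined <;> norm_num [BPos, edgeF]
  have s3 : JoinedIn goodSet (0.1965, 0.43042) (0.2535, 0.39345) := by
    apply seg_joined <;> norm_num [BPos, edgeF]
  have s4 : JoinedIn goodSet (0.2535, 0.39345) (0.324, 0.33) := by
    apply seg_joined <;> norm_num [BPos, edgeF]
  exact ((s1.trans s2).trans s3).trans s4

theorem box1 {a b : ℝ × ℝ} (ha : a ∈ Set.Icc (0.0705:ℝ) 0.0725 ×ˢ Set.Icc (0.4918:ℝ) 0.493)
    (hb : b ∈ Set.Icc (0.0705:ℝ) 0.0725 ×ˢ Set.Icc (0.4918:ℝ) 0.493) :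
    JoinedIn goodSet a b := by
  refine box_joined ?_ ?_ ?_ ?_ ?_ ?_ ?_ ?_ ha hb <;> norm_num [edgeF]

theorem box2 {a b : ℝ × ℝ} (ha : a ∈ Set.Icc (0.323:ℝ) 0.331 ×ˢ Set.Icc (0.323:ℝ) 0.331)
    (hb : b ∈ Set.Icc (0.323:ℝ) 0.331 ×ˢ Set.Icc (0.323:ℝ) 0.331) :
    JoinedIn goodSet a b := by
  refine box_joined ?_ ?_ ?_ ?_ ?_ ?_ ?_ ?_ ha hb <;> norm_num [edgeF]

/-- One half of the system, in polynomial form. -/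
theorem sol_edgeF {x y : ℝ} (hx : 0 < x) (hx3 : x < Real.sqrt 3 / 2)
    (h : y = (5 * x ^ 4 - 5 * x ^ 2 + 1) / (2 * (1 - x ^ 2) ^ 2)) :
    edgeF x y 1 = 0 ∧ y ≤ 1 / 2 := by
  have h3 : Real.sqrt 3 ^ 2 = 3 := Real.sq_sqrt (by norm_num)
  have hx2 : x ^ 2 < 3 / 4 := by nlinarith [Real.sqrt_nonneg 3]
  have hR : 0 < 1 - x ^ 2 := by linarith
  constructor
  · rw [edgeF, h]
    field_simp
    ring
  · rw [h, div_le_iff₀ (by positivity)]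
    nlinarith [mul_pos hx hx]

theorem sol_lower {x y q r : ℝ} (hF : edgeF x y 1 = 0) (hx : 0 < x) (hq : x ≤ q) (hq6 : q ≤ 3 / 5)
    (h : edgeF q r 1 < 0) : r < y := by
  by_contra hn
  push Not at hn
  have := edgeF_neg (p := x) (x := q) (u := y) (y := r) (L := 1) hx.le hq hq6 hn
    (by norm_num) (by norm_num) h
  linarith

theorem sol_upper {x y q r : ℝ} (hF : edgeF x y 1 = 0) (hx : x ≤ 3 / 5) (hq0 : 0 ≤ q) (hq : q ≤ x)
    (h : 0 < edgeF q r 1) : y < r := by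
  by_contra hn
  push Not at hn
  have := edgeF_pos (p := q) (x := x) (u := r) (y := y) (L := 1) hq0 hq hx hn
    (by norm_num) (by norm_num) h
  linarith

theorem sol_step {x y : ℝ} (h1 : edgeF x y 1 = 0) (h2 : edgeF y x 1 = 0) (hx : 0 < x)
    (hy : y ≤ 3 / 5) (q r p : ℝ) (hq : x ≤ q) (hq6 : q ≤ 3 / 5) (hr : 0 ≤ r)
    (e1 : edgeF q r 1 < 0) (e2 : 0 < edgeF r p 1) : x ≤ p := by
  have := sol_lower h1 hx hq hq6 e1
  exact (sol_upper h2 hy hr this.le e2).le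

/-- Localization of the solutions. -/
theorem sol_localize {x y : ℝ} (h1 : edgeF x y 1 = 0) (h2 : edgeF y x 1 = 0) (hx : 0 < x)
    (hx2 : x ≤ 1 / 2) (hy : 0 < y) (hy2 : y ≤ 1 / 2) :
    0.0705 ≤ x ∧ (x ≤ 0.0725 ∨ 0.324 ≤ x) := by
  constructor
  · have m0 : (0:ℝ) ≤ x := hx.le
    have n0 : y ≤ 0.5 := by linarith
    have m1 : 0.05555 < x := sol_lower h2 hy n0 (by norm_num) (by norm_num [edgeF])
    have n1 : y ≤ 0.49537 := (sol_upper h1 (by linarith) (by norm_num) m1.le (by norm_num [edgeF])).le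
    have m2 : 0.06508 < x := sol_lower h2 hy n1 (by norm_num) (by norm_num [edgeF])
    have n2 : y ≤ 0.49363 := (sol_upper h1 (by linarith) (by norm_num) m2.le (by norm_num [edgeF])).le
    have m3 : 0.06863 < x := sol_lower h2 hy n2 (by norm_num) (by norm_num [edgeF])
    have n3 : y ≤ 0.49292 := (sol_upper h1 (by linarith) (by norm_num) m3.le (by norm_num [edgeF])).le
    have m4 : 0.07007 < x := sol_lower h2 hy n3 (by norm_num) (by norm_num [edgeF])
    have n4 : y ≤ 0.49262 := (sol_upper h1 (by linarith) (by norm_num) m4.le (by norm_num [edgeF])).le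
    have m5 : 0.07068 < x := sol_lower h2 hy n4 (by norm_num) (by norm_num [edgeF])
    linarith
  · by_contra! hn
    obtain ⟨hn1, hn2⟩ := hn
    have k0 : x ≤ 0.324 := hn2.le
    have hy6 : y ≤ 3 / 5 := by linarith
    have k1 : x ≤ 0.32308 := sol_step h1 h2 hx hy6 0.324 0.33094 0.32308 k0
      (by norm_num) (by norm_num) (by norm_num [edgeF]) (by norm_num [edgeF])
    have k2 : x ≤ 0.32189 := sol_step h1 h2 hx hy6 0.32308 0.33197 0.32189 k1
      (by norm_num) (by norm_num) (by norm_num [edgeF]) (by norm_num [edgeF])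
    have k3 : x ≤ 0.32037 := sol_step h1 h2 hx hy6 0.32189 0.33329 0.32037 k2
      (by norm_num) (by norm_num) (by norm_num [edgeF]) (by norm_num [edgeF])
    have k4 : x ≤ 0.31841 := sol_step h1 h2 hx hy6 0.32037 0.33497 0.31841 k3
      (by norm_num) (by norm_num) (by norm_num [edgeF]) (by norm_num [edgeF])
    have k5 : x ≤ 0.31589 := sol_step h1 h2 hx hy6 0.31841 0.33712 0.31589 k4
      (by norm_num) (by norm_num) (by norm_num [edgeF]) (by norm_num [edgeF])
    have k6 : x ≤ 0.31264 := sol_step h1 h2 hx hy6 0.31589 0.33987 0.31264 k5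
      (by norm_num) (by norm_num) (by norm_num [edgeF]) (by norm_num [edgeF])
    have k7 : x ≤ 0.30846 := sol_step h1 h2 hx hy6 0.31264 0.34336 0.30846 k6
      (by norm_num) (by norm_num) (by norm_num [edgeF]) (by norm_num [edgeF])
    have k8 : x ≤ 0.30307 := sol_step h1 h2 hx hy6 0.30846 0.34779 0.30307 k7
      (by norm_num) (by norm_num) (by norm_num [edgeF]) (by norm_num [edgeF])
    have k9 : x ≤ 0.29612 := sol_step h1 h2 hx hy6 0.30307 0.3534 0.29612 k8
      (by norm_num) (by norm_num) (by norm_num [edgeF]) (by norm_num [edgeF])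
    have k10 : x ≤ 0.28718 := sol_step h1 h2 hx hy6 0.29612 0.36044 0.28718 k9
      (by norm_num) (by norm_num) (by norm_num [edgeF]) (by norm_num [edgeF])
    have k11 : x ≤ 0.27571 := sol_step h1 h2 hx hy6 0.28718 0.36921 0.27571 k10
      (by norm_num) (by norm_num) (by norm_num [edgeF]) (by norm_num [edgeF])
    have k12 : x ≤ 0.26113 := sol_step h1 h2 hx hy6 0.27571 0.37997 0.26113 k11
      (by norm_num) (by norm_num) (by norm_num [edgeF]) (by norm_num [edgeF])
    have k13 : x ≤ 0.24284 := sol_step h1 h2 hx hy6 0.26113 0.3929 0.24284 k12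
      (by norm_num) (by norm_num) (by norm_num [edgeF]) (by norm_num [edgeF])
    have k14 : x ≤ 0.22045 := sol_step h1 h2 hx hy6 0.24284 0.40796 0.22045 k13
      (by norm_num) (by norm_num) (by norm_num [edgeF]) (by norm_num [edgeF])
    have k15 : x ≤ 0.19416 := sol_step h1 h2 hx hy6 0.22045 0.42468 0.19416 k14
      (by norm_num) (by norm_num) (by norm_num [edgeF]) (by norm_num [edgeF])
    have k16 : x ≤ 0.16528 := sol_step h1 h2 hx hy6 0.19416 0.442 0.16528 k15
      (by norm_num) (by norm_num) (by norm_num [edgeF]) (by norm_num [edgeF])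
    have k17 : x ≤ 0.1366 := sol_step h1 h2 hx hy6 0.16528 0.45826 0.1366 k16
      (by norm_num) (by norm_num) (by norm_num [edgeF]) (by norm_num [edgeF])
    have k18 : x ≤ 0.11179 := sol_step h1 h2 hx hy6 0.1366 0.47165 0.11179 k17
      (by norm_num) (by norm_num) (by norm_num [edgeF]) (by norm_num [edgeF])
    have k19 : x ≤ 0.09363 := sol_step h1 h2 hx hy6 0.11179 0.48109 0.09363 k18
      (by norm_num) (by norm_num) (by norm_num [edgeF]) (by norm_num [edgeF])
    have k20 : x ≤ 0.08243 := sol_step h1 h2 hx hy6 0.09363 0.48677 0.08243 k19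
      (by norm_num) (by norm_num) (by norm_num [edgeF]) (by norm_num [edgeF])
    have k21 : x ≤ 0.07646 := sol_step h1 h2 hx hy6 0.08243 0.48976 0.07646 k20
      (by norm_num) (by norm_num) (by norm_num [edgeF]) (by norm_num [edgeF])
    have k22 : x ≤ 0.07358 := sol_step h1 h2 hx hy6 0.07646 0.49119 0.07358 k21
      (by norm_num) (by norm_num) (by norm_num [edgeF]) (by norm_num [edgeF])
    have k23 : x ≤ 0.07227 := sol_step h1 h2 hx hy6 0.07358 0.49184 0.07227 k22
      (by norm_num) (by norm_num) (by norm_num [edgeF]) (by norm_num [edgeF])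
    linarith

theorem sol_joined {p : ℝ × ℝ} (hp : EqPentSol p) : JoinedIn goodSet (0.0725, 0.492) p := by
  obtain ⟨x, y⟩ := p
  obtain ⟨hx, hx3, hy, hy3, e1, e2⟩ := hp
  simp only at hx hx3 hy hy3 e1 e2
  obtain ⟨f1, hy2⟩ := sol_edgeF hx hx3 e1
  obtain ⟨f2, hx2⟩ := sol_edgeF hy hy3 e2
  obtain ⟨lx, cx⟩ := sol_localize f1 f2 hx hx2 hy hy2
  obtain ⟨ly, cy⟩ := sol_localize f2 f1 hy hy2 hx hx2
  have case1 : ∀ x y : ℝ, edgeF x y 1 = 0 → 0.0705 ≤ x → x ≤ 0.0725 →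
      JoinedIn goodSet (0.0725, 0.492) (x, y) := by
    intro x y f1 l u
    have b1 : 0.4918 < y := sol_lower f1 (by linarith) u (by norm_num) (by norm_num [edgeF])
    have b2 : y < 0.493 := sol_upper f1 (by linarith) (by norm_num) l (by norm_num [edgeF])
    refine box1 ?_ ?_
    · norm_num
    · exact ⟨⟨l, u⟩, b1.le, b2.le⟩
  have mid : JoinedIn goodSet (0.324, 0.33) (0.33, 0.324) := by
    apply box2 <;> norm_num
  rcases cx with cx | cx
  · exact case1 x y f1 lx cx
  · rcases cy with cy | cy
    · have := swap_joined (case1 y x f2 ly cy)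
      have hc := swap_joined chain_joined.symm
      exact (chain_joined.trans mid).trans (hc.trans this)
    · refine chain_joined.trans (box2 (by norm_num) ?_)
      have b1 : y < 0.331 := sol_upper f1 (by linarith) (by norm_num) cx (by norm_num [edgeF])
      have b2 : x < 0.331 := sol_upper f2 (by linarith) (by norm_num) cy (by norm_num [edgeF])
      exact ⟨⟨by simp only; linarith, b2.le⟩, by simp only; linarith, b1.le⟩

/-- The system has finitely many positive solutions. -/
theorem sol_finite : {p : ℝ × ℝ | EqPentSol p}.Finite := by
  let D : Polynomial ℝ := 2 * (1 - Polynomial.X ^ 2) ^ 2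
  let N : Polynomial ℝ := 5 * Polynomial.X ^ 4 - 5 * Polynomial.X ^ 2 + 1
  let P : Polynomial ℝ := 2 * Polynomial.X * (D ^ 2 - N ^ 2) ^ 2 -
    (5 * N ^ 4 - 5 * N ^ 2 * D ^ 2 + D ^ 4)
  have hP : P ≠ 0 := by
    intro h
    have := congrArg (Polynomial.eval 1) h
    norm_num [P, D, N] at this
  have hfin : (P.roots.toFinset : Set ℝ).Finite := Finset.finite_toSet _
  refine (hfin.image (fun x => (x, (5 * x ^ 4 - 5 * x ^ 2 + 1) / (2 * (1 - x ^ 2) ^ 2)))).subset ?_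
  rintro ⟨x, y⟩ ⟨hx, hx3, hy, hy3, e1, e2⟩
  simp only at hx hx3 hy hy3 e1 e2
  refine ⟨x, ?_, by simp only [← e1]⟩
  obtain ⟨f1, hy2⟩ := sol_edgeF hx hx3 e1
  obtain ⟨f2, hx2⟩ := sol_edgeF hy hy3 e2
  simp only [Finset.mem_coe, Multiset.mem_toFinset, Polynomial.mem_roots hP, Polynomial.IsRoot.def]
  have hD : (2 * (1 - x ^ 2) ^ 2) ≠ 0 := by
    have : 0 < 1 - x ^ 2 := by nlinarith
    positivity
  have hN : 5 * x ^ 4 - 5 * x ^ 2 + 1 = y * (2 * (1 - x ^ 2) ^ 2) := by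
    rw [e1, div_mul_cancel₀ _ hD]
  have : P.eval x = 2 * x * ((2 * (1 - x ^ 2) ^ 2) ^ 2 - (5 * x ^ 4 - 5 * x ^ 2 + 1) ^ 2) ^ 2 -
      (5 * (5 * x ^ 4 - 5 * x ^ 2 + 1) ^ 4 -
        5 * (5 * x ^ 4 - 5 * x ^ 2 + 1) ^ 2 * (2 * (1 - x ^ 2) ^ 2) ^ 2
        + (2 * (1 - x ^ 2) ^ 2) ^ 4) := by
    simp [P, D, N]
  rw [this, hN]
  generalize 2 * (1 - x ^ 2) ^ 2 = d
  unfold edgeF at f2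
  linear_combination d ^ 4 * f2

/-- Model flexibility of the equilateral pentagonal Siamese dipyramids: a
continuous deformation through all three isomeric shapes whose relative
variations in edge lengths stay below `0.004` while the relative variation in
the heights exceeds `5.9`. -/
theorem eq_pent_siamese_model_flexibility :
    ∃ γ : ℝ → ℝ × ℝ, ContinuousOn γ (Set.Icc 0 1) ∧
      (∀ t ∈ Set.Icc (0:ℝ) 1, γ t ∈ ModuliD) ∧
      (∀ p : ℝ × ℝ, EqPentSol p → p ∈ γ '' Set.Icc (0:ℝ) 1) ∧
      (∀ t ∈ Set.Icc (0:ℝ) 1, |edgeL (γ t) - 1| < 0.004 ∧ |edgeLt (γ t) - 1| < 0.004) ∧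
      (∃ s ∈ Set.Icc (0:ℝ) 1, ∃ t ∈ Set.Icc (0:ℝ) 1,
        ((γ s).1 - (γ t).1) / (γ t).1 > 5.9) := by
  have mid : JoinedIn goodSet (0.324, 0.33) (0.33, 0.324) := by
    apply box2 <;> norm_num
  have jA : JoinedIn goodSet (0.0725, 0.492) (0.071, 0.492) := by
    apply box1 <;> norm_num
  have jB : JoinedIn goodSet (0.0725, 0.492) (0.492, 0.071) :=
    (chain_joined.trans mid).trans ((swap_joined chain_joined.symm).trans (swap_joined jA))
  have hc : IsPathConnected (pathComponentIn goodSet ((0.0725, 0.492) : ℝ × ℝ)) :=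
    isPathConnected_pathComponentIn jA.source_mem
  let T : Set (ℝ × ℝ) := insert (0.071, 0.492) (insert (0.492, 0.071) {p | EqPentSol p})
  have hT : T.Finite := (sol_finite.insert _).insert _
  have hTc : ∀ p ∈ T, p ∈ pathComponentIn goodSet ((0.0725, 0.492) : ℝ × ℝ) := by
    rintro p (rfl | rfl | hp)
    · exact jA
    · exact jB
    · exact sol_joined hp
  have : Finite T := hT
  obtain ⟨n, ⟨e⟩⟩ := Finite.exists_equiv_fin T
  cases n with
  | zero => exact (e ⟨(0.071, 0.492), Or.inl rfl⟩).elim0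
  | succ n =>
    obtain ⟨g, hg1, hg2⟩ := hc.exists_path_through_family (fun i => ((e.symm i : T) : ℝ × ℝ))
      (fun i => hTc _ (e.symm i).2)
    have hin : ∀ p ∈ T, p ∈ g.extend '' Set.Icc (0:ℝ) 1 := by
      intro p hp
      obtain ⟨t, ht⟩ := hg2 (e ⟨p, hp⟩)
      refine ⟨t, t.2, ?_⟩
      rw [Path.extend_apply g t.2]
      simpa using ht
    have hgood : ∀ t ∈ Set.Icc (0:ℝ) 1, g.extend t ∈ goodSet := by
      intro t ht
      rw [Path.extend_apply g ht]
      have : g ⟨t, ht⟩ ∈ pathComponentIn goodSet ((0.0725, 0.492) : ℝ × ℝ) :=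
        hg1 ⟨_, rfl⟩
      exact pathComponentIn_subset this
    refine ⟨g.extend, g.continuous_extend.continuousOn, fun t ht => (hgood t ht).1,
      fun p hp => hin p (Or.inr (Or.inr hp)), fun t ht => (hgood t ht).2, ?_⟩
    obtain ⟨t, ht, ht'⟩ := hin (0.071, 0.492) (Or.inl rfl)
    obtain ⟨s, hs, hs'⟩ := hin (0.492, 0.071) (Or.inr (Or.inl rfl))
    refine ⟨s, hs, t, ht, ?_⟩
    rw [ht', hs']
    norm_num
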